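/- Let S, Aα, Aν be nonempty finite types, P a transition function, πν a fixed victim policy, r : S → ℝ a reward, γ ∈ [0,1), and s₀ ∈ S. Let πα and π̃α be adversary policies with π̃α s aα > 0 for all s, aα. Let V be a value function for (r, Q[πα, πν]) and Ṽ a value function for (r, Q[π̃α, πν]). Then |Ṽ s₀ − V s₀| ≤ (γ · √(2 · ln 2) · max_{s ∈ S} |r s| / (1 − γ)²) · max_{s ∈ S} √(D_KL(πα s ‖ π̃α s)). (This is the strengthened form of Lemma 2 used in the proofs of Theorems 1 and 2, with the constant expressed via the maximal per-step reward rather than the maximal value.) -/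

import Mathlib

open Finset

/-- Base-2 KL divergence between probability vectors on a finite type. -/
noncomputable def klDiv {A : Type*} [Fintype A] (p q : A → ℝ) : ℝ :=
  ∑ a, p a * Real.logb 2 (p a / q a)

/-- A rational lower bound for the logarithm, with contact of order four at `1`. -/
lemma rational_le_log {x : ℝ} (hx : 0 < x) :
    5 / 2 - x⁻¹ / 4 - 27 / 4 * (x + 2)⁻¹ ≤ Real.log x := by
  let f : ℝ → ℝ := fun y => Real.log y - (5 / 2 - y⁻¹ / 4 - 27 / 4 * (y + 2)⁻¹)
  have hd : ∀ y : ℝ, 0 < y → HasDerivAt f ((y - 1) ^ 3 / (y ^ 2 * (y + 2) ^ 2)) y := by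
    intro y hy
    have h2 : y + 2 ≠ 0 := by positivity
    have h := (Real.hasDerivAt_log hy.ne').sub
      ((((hasDerivAt_inv hy.ne').div_const 4).const_sub (5 / 2)).sub
        ((((hasDerivAt_id y).add_const 2).fun_inv h2).const_mul (27 / 4)))
    refine HasDerivAt.congr_deriv (f := f) h ?_
    simp only [id]
    field_simp
    ring
  have h1 : f 1 = 0 := by norm_num [f]
  suffices 0 ≤ f x by simpa [f] using this
  rcases le_total x 1 with h | h
  · have hanti : AntitoneOn f (Set.Ioc 0 1) := by
      refine antitoneOn_of_deriv_nonpos (convex_Ioc 0 1)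
        (fun y hy => (hd y hy.1).continuousAt.continuousWithinAt)
        (fun y hy => ?_) (fun y hy => ?_)
      all_goals rw [interior_Ioc] at hy
      · exact (hd y hy.1).differentiableAt.differentiableWithinAt
      · rw [(hd y hy.1).deriv]
        exact div_nonpos_of_nonpos_of_nonneg
          (Odd.pow_nonpos (by decide) (by linarith [hy.2])) (by positivity)
    exact h1 ▸ hanti ⟨hx, h⟩ ⟨one_pos, le_rfl⟩ h
  · have hmono : MonotoneOn f (Set.Ici 1) := by
      have hpos : ∀ y : ℝ, 1 ≤ y → 0 < y := fun y hy => one_pos.trans_le hy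
      refine monotoneOn_of_deriv_nonneg (convex_Ici 1)
        (fun y hy => (hd y (hpos y hy)).continuousAt.continuousWithinAt)
        (fun y hy => ?_) (fun y hy => ?_)
      all_goals rw [interior_Ici] at hy
      · exact (hd y (hpos y (le_of_lt hy))).differentiableAt.differentiableWithinAt
      · rw [(hd y (hpos y (le_of_lt hy))).deriv]
        have : 0 ≤ y - 1 := sub_nonneg.2 (le_of_lt hy)
        positivity
    exact h1 ▸ hmono (Set.mem_Ici.2 le_rfl) h h

/-- The pointwise inequality behind Pinsker's inequality. -/
lemma sq_sub_div_le_mul_log_div {p q : ℝ} (hp : 0 ≤ p) (hq : 0 < q) :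
    3 / 2 * ((p - q) ^ 2 / (p + 2 * q)) ≤ p * Real.log (p / q) - p + q := by
  rcases hp.eq_or_lt with rfl | hp
  · have : 3 / 2 * ((0 - q) ^ 2 / (0 + 2 * q)) = 3 / 4 * q := by
      field_simp
      ring
    rw [this]
    linarith
  · have h := mul_le_mul_of_nonneg_left (rational_le_log (div_pos hp hq)) hp.le
    have e : p * (5 / 2 - (p / q)⁻¹ / 4 - 27 / 4 * (p / q + 2)⁻¹) =
        3 / 2 * ((p - q) ^ 2 / (p + 2 * q)) + p - q := by
      have : p / q + 2 = (p + 2 * q) / q := by field_simp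
      rw [this]
      field_simp
      ring
    linarith

/-- Pinsker's inequality for probability vectors on a finite type, with base-2 divergence. -/
lemma sum_abs_sub_le_sqrt_klDiv {A : Type*} [Fintype A] {p q : A → ℝ}
    (hp : ∀ a, 0 ≤ p a) (hq : ∀ a, 0 < q a) (hp1 : ∑ a, p a = 1) (hq1 : ∑ a, q a = 1) :
    ∑ a, |q a - p a| ≤ Real.sqrt (2 * Real.log 2) * Real.sqrt (klDiv p q) := by
  have hlog : 0 < Real.log 2 := Real.log_pos (by norm_num)
  have hden : ∀ a, 0 < p a + 2 * q a := fun a => by linarith [hp a, hq a]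
  have hkl : Real.log 2 * klDiv p q = ∑ a, p a * Real.log (p a / q a) := by
    rw [klDiv, mul_sum]
    refine sum_congr rfl fun a _ => ?_
    rw [Real.logb]
    field_simp
  have hle : 3 / 2 * ∑ a, (p a - q a) ^ 2 / (p a + 2 * q a) ≤ Real.log 2 * klDiv p q := by
    have h := sum_le_sum fun a (_ : a ∈ univ) => sq_sub_div_le_mul_log_div (hp a) (hq a)
    rw [← mul_sum, sum_add_distrib, sum_sub_distrib, hp1, hq1] at h
    linarith
  have hcs := sum_sq_le_sum_mul_sum_of_sq_le_mul univ (r := fun a => |q a - p a|)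
    (f := fun a => (p a - q a) ^ 2 / (p a + 2 * q a)) (g := fun a => p a + 2 * q a)
    (fun a _ => div_nonneg (sq_nonneg _) (hden a).le) (fun a _ => (hden a).le)
    (fun a _ => by
      rw [div_mul_cancel₀ _ (hden a).ne', sq_abs, sub_sq_comm])
  rw [sum_add_distrib, ← mul_sum, hp1, hq1] at hcs
  rw [← Real.sqrt_mul (by positivity)]
  exact Real.le_sqrt_of_sq_le (by linarith)

lemma abs_sum_mul_le_sum_abs_mul {A : Type*} [Fintype A] (w f : A → ℝ) {M : ℝ}
    (hf : ∀ a, |f a| ≤ M) : |∑ a, w a * f a| ≤ (∑ a, |w a|) * M := by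
  rw [sum_mul]
  refine (abs_sum_le_sum_abs _ _).trans (sum_le_sum fun a _ => ?_)
  rw [abs_mul]
  exact mul_le_mul_of_nonneg_left (hf a) (abs_nonneg _)

lemma abs_sum_mul_le_of_sum_eq_one {A : Type*} [Fintype A] {w f : A → ℝ} {M : ℝ}
    (hw : ∀ a, 0 ≤ w a) (hw1 : ∑ a, w a = 1) (hf : ∀ a, |f a| ≤ M) :
    |∑ a, w a * f a| ≤ M := by
  simpa [abs_of_nonneg, hw, hw1] using abs_sum_mul_le_sum_abs_mul w f hf

/-- Solutions of a discounted Bellman equation are bounded by the bound on the source term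
divided by `1 - γ`. -/
lemma abs_le_div_of_bellman {S : Type*} [Fintype S] {γ : ℝ} (hγ0 : 0 ≤ γ) (hγ1 : γ < 1)
    {b W : S → ℝ} {K : S → S → ℝ} {C : ℝ} (hb : ∀ s, |b s| ≤ C)
    (hK : ∀ s s', 0 ≤ K s s') (hK1 : ∀ s, ∑ s', K s s' = 1)
    (hW : ∀ s, W s = b s + γ * ∑ s', K s s' * W s') (s : S) :
    |W s| ≤ C / (1 - γ) := by
  have : Nonempty S := ⟨s⟩
  obtain ⟨m, hm⟩ := Finite.exists_max fun s => |W s|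
  refine (hm s).trans ((le_div_iff₀ (by linarith)).2 ?_)
  have h1 : |W m| ≤ |b m| + γ * |∑ s', K m s' * W s'| := by
    conv_lhs => rw [hW m]
    refine (abs_add_le _ _).trans_eq ?_
    rw [abs_mul, abs_of_nonneg hγ0]
  have h2 := mul_le_mul_of_nonneg_left
    (abs_sum_mul_le_of_sum_eq_one (hK m) (hK1 m) hm) hγ0
  linarith [hb m]

theorem victim_return_gap_KL_bound_reward_constant
    {S Aα Aν : Type*} [Fintype S] [Nonempty S] [Fintype Aα] [Nonempty Aα]
    [Fintype Aν] [Nonempty Aν]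
    (P : S → Aα → Aν → S → ℝ)
    (hPnn : ∀ s aα aν s', 0 ≤ P s aα aν s')
    (hPsum : ∀ s aα aν, ∑ s', P s aα aν s' = 1)
    (πν : S → Aν → ℝ)
    (hπνnn : ∀ s aν, 0 ≤ πν s aν) (hπνsum : ∀ s, ∑ aν, πν s aν = 1)
    (r : S → ℝ) (γ : ℝ) (hγ0 : 0 ≤ γ) (hγ1 : γ < 1) (s₀ : S)
    (πα πα' : S → Aα → ℝ)
    (hπαnn : ∀ s aα, 0 ≤ πα s aα) (hπαsum : ∀ s, ∑ aα, πα s aα = 1)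
    (hπα'pos : ∀ s aα, 0 < πα' s aα) (hπα'sum : ∀ s, ∑ aα, πα' s aα = 1)
    (V V' : S → ℝ)
    (hV : ∀ s, V s = r s +
      γ * ∑ s', (∑ aα, ∑ aν, πα s aα * πν s aν * P s aα aν s') * V s')
    (hV' : ∀ s, V' s = r s +
      γ * ∑ s', (∑ aα, ∑ aν, πα' s aα * πν s aν * P s aα aν s') * V' s') :
    |V' s₀ - V s₀| ≤
      γ * Real.sqrt (2 * Real.log 2) * (⨆ s, |r s|) / (1 - γ) ^ 2 *
        ⨆ s, Real.sqrt (klDiv (πα s) (πα' s)) := by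
  let R : S → Aα → S → ℝ := fun s a s' => ∑ b, πν s b * P s a b s'
  have hRnn : ∀ s a s', 0 ≤ R s a s' := fun s a s' =>
    sum_nonneg fun b _ => mul_nonneg (hπνnn s b) (hPnn s a b s')
  have hR1 : ∀ s a, ∑ s', R s a s' = 1 := fun s a => by
    simp only [R]
    rw [sum_comm]
    simp only [← mul_sum, hPsum, mul_one, hπνsum]
  have hker : ∀ (π : S → Aα → ℝ) s s',
      ∑ a, ∑ b, π s a * πν s b * P s a b s' = ∑ a, π s a * R s a s' := fun π s s' => by
    simp only [R, mul_sum, mul_assoc]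
  simp only [hker] at hV hV'
  have hKnn : ∀ π : S → Aα → ℝ, (∀ s a, 0 ≤ π s a) → ∀ s s', 0 ≤ ∑ a, π s a * R s a s' :=
    fun π hπ s s' => sum_nonneg fun a _ => mul_nonneg (hπ s a) (hRnn s a s')
  have hK1 : ∀ π : S → Aα → ℝ, (∀ s, ∑ a, π s a = 1) → ∀ s, ∑ s', ∑ a, π s a * R s a s' = 1 :=
    fun π hπ s => by
      rw [sum_comm]
      simp only [← mul_sum, hR1, mul_one, hπ]
  have happly : ∀ (π : S → Aα → ℝ) s,
      ∑ s', (∑ a, π s a * R s a s') * V s' = ∑ a, π s a * ∑ s', R s a s' * V s' := fun π s => by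
    simp only [sum_mul, mul_sum, mul_assoc]
    exact sum_comm
  have hVle : ∀ s, |V s| ≤ (⨆ s, |r s|) / (1 - γ) :=
    abs_le_div_of_bellman hγ0 hγ1 (fun s => le_ciSup (f := fun s => |r s|)
      (Set.finite_range _).bddAbove s) (hKnn πα hπαnn) (hK1 πα hπαsum) hV
  have hdiff : ∀ s, V' s - V s =
      γ * ∑ a, (πα' s a - πα s a) * (∑ s', R s a s' * V s') +
        γ * ∑ s', (∑ a, πα' s a * R s a s') * (V' s' - V s') := fun s => by
    rw [hV' s, hV s]
    simp only [mul_sub, sub_mul, sum_sub_distrib, happly]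
    ring
  have hsource : ∀ s, |γ * ∑ a, (πα' s a - πα s a) * (∑ s', R s a s' * V s')| ≤
      γ * ((Real.sqrt (2 * Real.log 2) * ⨆ s, Real.sqrt (klDiv (πα s) (πα' s))) *
        ((⨆ s, |r s|) / (1 - γ))) := fun s => by
    rw [abs_mul, abs_of_nonneg hγ0]
    refine mul_le_mul_of_nonneg_left ?_ hγ0
    refine (abs_sum_mul_le_sum_abs_mul _ _ fun a =>
      abs_sum_mul_le_of_sum_eq_one (hRnn s a) (hR1 s a) hVle).trans ?_
    refine mul_le_mul_of_nonneg_right ?_ ((abs_nonneg _).trans (hVle s))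
    refine (sum_abs_sub_le_sqrt_klDiv (hπαnn s) (hπα'pos s) (hπαsum s) (hπα'sum s)).trans ?_
    exact mul_le_mul_of_nonneg_left (le_ciSup (f := fun s => Real.sqrt (klDiv (πα s) (πα' s)))
      (Set.finite_range _).bddAbove s) (Real.sqrt_nonneg _)
  refine (abs_le_div_of_bellman (W := fun s => V' s - V s) hγ0 hγ1 hsource
    (hKnn πα' fun s a => (hπα'pos s a).le) (hK1 πα' hπα'sum) hdiff s₀).trans_eq ?_
  have : 1 - γ ≠ 0 := by linarith
  field_simp
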